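/- arXiv:1009.5147 — 3 statements merged into one kernel-verified Lean document; each statement's English description precedes it below -/
import Mathlib

section
/- In the presented Heisenberg algebra 𝔥, for every vertex i ∈ I and all integers m, n ≥ 0 one has q_i^{(1^m)}·p_i^{(n)} = p_i^{(n)}·q_i^{(1^m)} + [2]·p_i^{(n−1)}·q_i^{(1^{m−1})} + p_i^{(n−2)}·q_i^{(1^{m−2})}, where [2] = t + t⁻¹ and terms with negative superscripts are zero. This is the mixed commutation relation between transposed and untransposed generators stated in Section 2 of the paper. -/
/-!
We formalize the quantum Heisenberg algebra `𝔥` associated to a simple graph with vertex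
set `I` (in the paper, the affine Dynkin diagram of a nontrivial finite subgroup
`Γ ⊂ SL₂(ℂ)`, `Γ ≠ ℤ/2`), presented over `K = ℚ(t)` by generators `aᵢ(n)` (`i ∈ I`,
`n ∈ ℤ ∖ {0}`) and the relations
`aᵢ(m)aⱼ(n) = aⱼ(n)aᵢ(m)` for `m + n ≠ 0` and
`aᵢ(-n)aⱼ(n) - aⱼ(n)aᵢ(-n) = κᵢⱼ(n)·1` for `n ≥ 1`, where `κᵢᵢ(n) = -[2n][n]/n`,
`κᵢⱼ(n) = (-1)ⁿ[n]²/n` if `i ∼ j` and `κᵢⱼ(n) = 0` otherwise.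
-/

open scoped Classical

noncomputable section

/-- The base field `K = ℚ(t)`. -/
abbrev K : Type := RatFunc ℚ

/-- The variable `t ∈ K = ℚ(t)`. -/
def tv : K := RatFunc.X

/-- The quantum integer `[n] = (tⁿ - t⁻ⁿ)/(t - t⁻¹)`. -/
def qint (n : ℤ) : K := (tv ^ n - tv ^ (-n)) / (tv - tv⁻¹)

/-- The quantum integer `[k+1] = t^{-k} + t^{-k+2} + ⋯ + t^{k-2} + t^k`. -/
def qnat (k : ℕ) : K := ∑ j ∈ Finset.range (k + 1), tv ^ (2 * (j : ℤ) - (k : ℤ))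

/-- Index type for the generators `aᵢ(n)`, `i ∈ I`, `n ∈ ℤ ∖ {0}`. -/
abbrev Gen (I : Type) : Type := I × {n : ℤ // n ≠ 0}

/-- The structure constants `κᵢⱼ(n)`:  `κᵢᵢ(n) = -[2n][n]/n`,
`κᵢⱼ(n) = (-1)ⁿ[n]²/n` if `i ∼ j`, and `κᵢⱼ(n) = 0` otherwise. -/
def kappa {I : Type} (G : SimpleGraph I) (i j : I) (n : ℤ) : K :=
  if i = j then -(qint (2 * n) * qint n / (n : K))
  else if G.Adj i j then (-1 : K) ^ n * qint n ^ 2 / (n : K)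
  else 0

/-- The defining relations of the Heisenberg algebra:
`aᵢ(m)aⱼ(n) = aⱼ(n)aᵢ(m)` whenever `m + n ≠ 0`, and
`aᵢ(-n)aⱼ(n) - aⱼ(n)aᵢ(-n) = κᵢⱼ(n)·1` for all `n ≥ 1`. -/
inductive HeisRel {I : Type} (G : SimpleGraph I) :
    FreeAlgebra K (Gen I) → FreeAlgebra K (Gen I) → Prop
  | comm (i j : I) (m n : {k : ℤ // k ≠ 0}) (h : (m : ℤ) + (n : ℤ) ≠ 0) :
      HeisRel G (FreeAlgebra.ι K (i, m) * FreeAlgebra.ι K (j, n))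
        (FreeAlgebra.ι K (j, n) * FreeAlgebra.ι K (i, m))
  | heis (i j : I) (n : ℤ) (hn : 1 ≤ n) :
      HeisRel G
        (FreeAlgebra.ι K (i, ⟨-n, by omega⟩) * FreeAlgebra.ι K (j, ⟨n, by omega⟩) -
          FreeAlgebra.ι K (j, ⟨n, by omega⟩) * FreeAlgebra.ι K (i, ⟨-n, by omega⟩))
        (algebraMap K (FreeAlgebra K (Gen I)) (kappa G i j n))

/-- The Heisenberg algebra `𝔥`, presented by generators and relations. -/
abbrev HeisAlg {I : Type} (G : SimpleGraph I) : Type := RingQuot (HeisRel G)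

/-- The generators `aᵢ(n)` of `𝔥` (with the harmless convention `aᵢ(0) = 0`). -/
def aGen {I : Type} (G : SimpleGraph I) (i : I) (n : ℤ) : HeisAlg G :=
  if h : n ≠ 0 then RingQuot.mkAlgHom K (HeisRel G) (FreeAlgebra.ι K (i, ⟨n, h⟩)) else 0

/-- `p_i^{(n)}` for `n : ℕ`, defined by `p_i^{(0)} = 1` and the recursion
`n·p_i^{(n)} = Σ_{m=1}^{n} (m/[m])·aᵢ(-m)·p_i^{(n-m)}`. -/
def pAux {I : Type} (G : SimpleGraph I) (i : I) : ℕ → HeisAlg G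
  | 0 => 1
  | n + 1 =>
      (((n : K) + 1))⁻¹ • ∑ m ∈ Finset.range (n + 1),
        ((((m : K) + 1)) / qint ((m : ℤ) + 1)) •
          (aGen G i (-((m : ℤ) + 1)) * pAux G i (n - m))
  decreasing_by exact Nat.lt_succ_of_le (Nat.sub_le n m)

/-- `q_i^{(n)}` for `n : ℕ`, defined by `q_i^{(0)} = 1` and the recursion
`n·q_i^{(n)} = Σ_{m=1}^{n} (m/[m])·aᵢ(m)·q_i^{(n-m)}`. -/
def qAux {I : Type} (G : SimpleGraph I) (i : I) : ℕ → HeisAlg G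
  | 0 => 1
  | n + 1 =>
      (((n : K) + 1))⁻¹ • ∑ m ∈ Finset.range (n + 1),
        ((((m : K) + 1)) / qint ((m : ℤ) + 1)) •
          (aGen G i ((m : ℤ) + 1) * qAux G i (n - m))
  decreasing_by exact Nat.lt_succ_of_le (Nat.sub_le n m)

/-- `p_i^{(k)}` for `k : ℤ`, vanishing for `k < 0`. -/
def pH {I : Type} (G : SimpleGraph I) (i : I) (k : ℤ) : HeisAlg G :=
  if k < 0 then 0 else pAux G i k.toNat

/-- `q_i^{(k)}` for `k : ℤ`, vanishing for `k < 0`. -/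
def qH {I : Type} (G : SimpleGraph I) (i : I) (k : ℤ) : HeisAlg G :=
  if k < 0 then 0 else qAux G i k.toNat

/-- The transposed element `p_i^{(1ⁿ)}` for `n : ℕ`, defined by `p_i^{(1⁰)} = 1` and the
recursion `n·p_i^{(1ⁿ)} = Σ_{m=1}^{n} (-1)^{m+1}(m/[m])·aᵢ(-m)·p_i^{(1^{n-m})}`. -/
def pAux' {I : Type} (G : SimpleGraph I) (i : I) : ℕ → HeisAlg G
  | 0 => 1
  | n + 1 =>
      (((n : K) + 1))⁻¹ • ∑ m ∈ Finset.range (n + 1),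
        ((-1 : K) ^ m * (((m : K) + 1)) / qint ((m : ℤ) + 1)) •
          (aGen G i (-((m : ℤ) + 1)) * pAux' G i (n - m))
  decreasing_by exact Nat.lt_succ_of_le (Nat.sub_le n m)

/-- The transposed element `q_i^{(1ⁿ)}` for `n : ℕ`, defined by `q_i^{(1⁰)} = 1` and the
recursion `n·q_i^{(1ⁿ)} = Σ_{m=1}^{n} (-1)^{m+1}(m/[m])·aᵢ(m)·q_i^{(1^{n-m})}`. -/
def qAux' {I : Type} (G : SimpleGraph I) (i : I) : ℕ → HeisAlg G
  | 0 => 1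
  | n + 1 =>
      (((n : K) + 1))⁻¹ • ∑ m ∈ Finset.range (n + 1),
        ((-1 : K) ^ m * (((m : K) + 1)) / qint ((m : ℤ) + 1)) •
          (aGen G i ((m : ℤ) + 1) * qAux' G i (n - m))
  decreasing_by exact Nat.lt_succ_of_le (Nat.sub_le n m)

/-- `p_i^{(1ᵏ)}` for `k : ℤ`, vanishing for `k < 0`. -/
def pH' {I : Type} (G : SimpleGraph I) (i : I) (k : ℤ) : HeisAlg G :=
  if k < 0 then 0 else pAux' G i k.toNat

/-- `q_i^{(1ᵏ)}` for `k : ℤ`, vanishing for `k < 0`. -/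
def qH' {I : Type} (G : SimpleGraph I) (i : I) (k : ℤ) : HeisAlg G :=
  if k < 0 then 0 else qAux' G i k.toNat

/-- If `p` is the exponential-type sequence generated by `β` and `α` commutes with `β` up to a
scalar in one degree, then `α` acts on `p` as a shift. -/
theorem mul_expSeq_comm {F A : Type*} [Field F] [CharZero F] [Ring A] [Algebra F A]
    (β : ℕ → A) (p : ℤ → A) (hneg : ∀ n < 0, p n = 0) (hzero : p 0 = 1)
    (hrec : ∀ (n : ℤ) (N : ℕ), n ≤ N →
      (n : F) • p n = ∑ r ∈ Finset.range N, β r * p (n - (r + 1)))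
    (α : A) (m : ℕ) (s : F)
    (hcomm : ∀ r, α * β r = β r * α + algebraMap F A (if r = m then ((m : F) + 1) * s else 0))
    (n : ℤ) : α * p n = p n * α + s • p (n - (m + 1)) := by
  rcases lt_or_ge n 0 with hn | hn
  · rw [hneg n hn, hneg _ (by omega)]; simp
  lift n to ℕ using hn
  induction n using Nat.strong_induction_on with
  | _ n ih =>
  rcases Nat.eq_zero_or_pos n with rfl | hn
  · rw [hneg ((0 : ℕ) - (m + 1)) (by omega)]; simp [hzero]
  have hnF : (n : F) ≠ 0 := by exact_mod_cast hn.ne'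
  have ih' : ∀ r : ℕ, α * p (n - (r + 1)) =
      p (n - (r + 1)) * α + s • p (n - (r + 1) - (m + 1)) := by
    intro r
    rcases lt_or_ge ((n : ℤ) - (r + 1)) 0 with h | h
    · rw [hneg _ h, hneg _ (by omega)]; simp
    · obtain ⟨k, hk⟩ := Int.eq_ofNat_of_zero_le h
      rw [hk]; exact ih k (by omega)
  have hterm : ∀ r : ℕ, α * (β r * p (n - (r + 1))) =
      β r * p (n - (r + 1)) * α + s • (β r * p (n - (m + 1) - (r + 1))) +
        if r = m then (((m : F) + 1) * s) • p (n - (m + 1)) else 0 := by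
    intro r
    rw [← mul_assoc, hcomm, add_mul, mul_assoc, ih', mul_add, mul_smul_comm, ← mul_assoc,
      sub_right_comm, ← Algebra.smul_def]
    split_ifs with h
    · rw [h]
    · rw [zero_smul]
  have h₁ := hrec n n le_rfl
  have h₂ := hrec (n - (m + 1)) n (by omega)
  have hsingle : (∑ r ∈ Finset.range n,
      if r = m then (((m : F) + 1) * s) • p (n - (m + 1)) else 0) =
      (((m : F) + 1) * s) • p (n - (m + 1)) := by
    rw [Finset.sum_ite_eq']
    split_ifs with h
    · rfl
    · rw [hneg _ (by simp at h; omega), smul_zero]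
  have key : (n : F) • (α * p n) = (n : F) • (p n * α + s • p (n - (m + 1))) := by
    push_cast at h₁ h₂
    rw [← mul_smul_comm, h₁, Finset.mul_sum, Finset.sum_congr rfl fun r _ => hterm r,
      Finset.sum_add_distrib, Finset.sum_add_distrib, hsingle, ← Finset.smul_sum, ← h₂,
      ← Finset.sum_mul, ← h₁, smul_mul_assoc]
    module
  exact smul_right_injective A hnF key

/-- Telescoping of `∑ₘ sₘ (Xₘ + e Xₘ₊₁ + Xₘ₊₂)` when `s` satisfies the linear recurrence with
characteristic polynomial `1 + e x + x²`. -/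
theorem sum_smul_recurrence {F A : Type*} [Field F] [AddCommGroup A] [Module F A]
    (s : ℕ → F) (e : F) (h0 : s 0 = -2) (h1 : s 1 = e)
    (hs : ∀ k, s (k + 2) + e * s (k + 1) + s k = 0) (X : ℕ → A) (N : ℕ) :
    ∑ m ∈ Finset.range N, s (m + 1) • (X (m + 1) + e • X (m + 2) + X (m + 3)) =
      e • X 1 + (2 : F) • X 2 - s (N + 1) • X (N + 1) + s N • X (N + 2) := by
  induction N with
  | zero => simp [h0, h1]
  | succ N ih =>
    have hN : s (N + 1 + 1) = -(e * s (N + 1) + s N) := by linear_combination hs N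
    rw [Finset.sum_range_succ, ih, hN]
    module

/-- Commutation of two exponential-type sequences whose generators form a Heisenberg pair, where
the exponentiated commutator is the polynomial `1 + e x + x²`. -/
theorem expSeq_mul_expSeq {F A : Type*} [Field F] [CharZero F] [Ring A] [Algebra F A]
    (α β : ℕ → A) (p q : ℤ → A)
    (hp_neg : ∀ n < 0, p n = 0) (hp_zero : p 0 = 1)
    (hp : ∀ (n : ℤ) (N : ℕ), n ≤ N →
      (n : F) • p n = ∑ r ∈ Finset.range N, β r * p (n - (r + 1)))
    (hq_neg : ∀ n < 0, q n = 0) (hq_zero : q 0 = 1)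
    (hq : ∀ (n : ℤ) (N : ℕ), n ≤ N →
      (n : F) • q n = ∑ r ∈ Finset.range N, α r * q (n - (r + 1)))
    (s : ℕ → F) (e : F) (h0 : s 0 = -2) (h1 : s 1 = e)
    (hs : ∀ k, s (k + 2) + e * s (k + 1) + s k = 0)
    (hcomm : ∀ m r, α m * β r =
      β r * α m + algebraMap F A (if r = m then ((m : F) + 1) * s (m + 1) else 0))
    (M n : ℤ) :
    q M * p n = p n * q M + e • (p (n - 1) * q (M - 1)) + p (n - 2) * q (M - 2) := by
  rcases lt_or_ge M 0 with hM | hM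
  · rw [hq_neg M hM, hq_neg _ (by omega), hq_neg _ (by omega)]; simp
  lift M to ℕ using hM
  induction M using Nat.strong_induction_on with
  | _ M ih =>
  rcases Nat.eq_zero_or_pos M with rfl | hM
  · rw [hq_neg ((0 : ℕ) - 1) (by omega), hq_neg ((0 : ℕ) - 2) (by omega)]; simp [hq_zero]
  have hMF : (M : F) ≠ 0 := by exact_mod_cast hM.ne'
  have ih' : ∀ m : ℕ, q (M - (m + 1)) * p n = p n * q (M - (m + 1)) +
      e • (p (n - 1) * q (M - (m + 1) - 1)) + p (n - 2) * q (M - (m + 1) - 2) := by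
    intro m
    rcases lt_or_ge ((M : ℤ) - (m + 1)) 0 with h | h
    · rw [hq_neg _ h, hq_neg _ (by omega), hq_neg _ (by omega)]; simp
    · obtain ⟨k, hk⟩ := Int.eq_ofNat_of_zero_le h
      rw [hk]; exact ih k (by omega)
  have hα (m : ℕ) (k : ℤ) :=
    mul_expSeq_comm β p hp_neg hp_zero hp (α m) m (s (m + 1)) (hcomm m) k
  let X : ℕ → A := fun j => p (n - j) * q (M - j)
  have hterm : ∀ m : ℕ, α m * q (M - (m + 1)) * p n =
      p n * (α m * q (M - (m + 1))) + e • (p (n - 1) * (α m * q (M - 1 - (m + 1)))) +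
        p (n - 2) * (α m * q (M - 2 - (m + 1))) +
        s (m + 1) • (X (m + 1) + e • X (m + 2) + X (m + 3)) := by
    intro m
    have e₁ : X (m + 1) = p (n - (m + 1)) * q (M - (m + 1)) := by simp [X]
    have e₂ : X (m + 2) = p (n - 1 - (m + 1)) * q (M - 1 - (m + 1)) := by
      simp only [X]; congr 2 <;> push_cast <;> ring
    have e₃ : X (m + 3) = p (n - 2 - (m + 1)) * q (M - 2 - (m + 1)) := by
      simp only [X]; congr 2 <;> push_cast <;> ring
    rw [mul_assoc, ih', sub_right_comm (M : ℤ) _ 1, sub_right_comm (M : ℤ) _ 2, e₁, e₂, e₃]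
    simp only [mul_add, mul_smul_comm, ← mul_assoc, hα, add_mul, smul_mul_assoc]
    module
  have hq₀ := hq M M le_rfl
  have hq₁ := hq (M - 1) M (by omega)
  have hq₂ := hq (M - 2) M (by omega)
  push_cast at hq₀ hq₁ hq₂
  have hX₁ : X (M + 1) = 0 := by simp only [X]; rw [hq_neg _ (by omega), mul_zero]
  have hX₂ : X (M + 2) = 0 := by simp only [X]; rw [hq_neg _ (by omega), mul_zero]
  have key : (M : F) • (q M * p n) = (M : F) •
      (p n * q M + e • (p (n - 1) * q (M - 1)) + p (n - 2) * q (M - 2)) := by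
    rw [← smul_mul_assoc, hq₀, Finset.sum_mul, Finset.sum_congr rfl fun m _ => hterm m]
    simp only [Finset.sum_add_distrib, ← Finset.smul_sum, ← Finset.mul_sum]
    rw [sum_smul_recurrence s e h0 h1 hs, hX₁, hX₂, ← hq₀, ← hq₁, ← hq₂]
    simp only [X, mul_smul_comm, Nat.cast_one, Nat.cast_ofNat]
    module
  exact smul_right_injective A hMF key

/-- The recursion defining an exponential-type sequence, for its extension by zero to `ℤ` and with
any sufficiently large range of summation. -/
theorem expSeq_rec_extend {F A : Type*} [Field F] [CharZero F] [Ring A] [Algebra F A]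
    (β : ℕ → A) (f : ℕ → A) (p : ℤ → A)
    (hp : ∀ n, p n = if n < 0 then 0 else f n.toNat)
    (hf : ∀ n : ℕ, f (n + 1) = ((n : F) + 1)⁻¹ •
      ∑ m ∈ Finset.range (n + 1), β m * f (n - m))
    (n : ℤ) (N : ℕ) (hN : n ≤ N) :
    (n : F) • p n = ∑ r ∈ Finset.range N, β r * p (n - (r + 1)) := by
  have hneg : ∀ n < 0, p n = 0 := fun n hn => by rw [hp, if_pos hn]
  rcases lt_trichotomy n 0 with hn | rfl | hn
  · rw [hneg n hn, smul_zero, Finset.sum_eq_zero]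
    intro r _
    rw [hneg _ (by omega), mul_zero]
  · rw [Int.cast_zero, zero_smul, Finset.sum_eq_zero]
    intro r _
    rw [hneg _ (by omega), mul_zero]
  obtain ⟨k, rfl⟩ : ∃ k : ℕ, n = (k + 1 : ℕ) := ⟨(n - 1).toNat, by omega⟩
  have hk : ((k : F) + 1) ≠ 0 := by exact_mod_cast Nat.succ_ne_zero k
  have hsub : Finset.range (k + 1) ⊆ Finset.range N := by
    intro r hr; simp only [Finset.mem_range] at *; omega
  rw [← Finset.sum_subset hsub]
  · rw [hp, if_neg (by omega), Int.toNat_natCast, hf]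
    push_cast
    rw [smul_inv_smul₀ hk]
    refine Finset.sum_congr rfl fun m hm => ?_
    rw [Finset.mem_range] at hm
    rw [hp, if_neg (by omega)]
    congr 2
    omega
  · intro r _ hr
    rw [Finset.mem_range] at hr
    rw [hneg _ (by omega), mul_zero]

theorem tv_ne_zero : tv ≠ 0 := RatFunc.X_ne_zero

theorem tv_pow_ne_one {n : ℕ} (hn : n ≠ 0) : tv ^ n ≠ 1 := by
  intro h
  have h' : (algebraMap (Polynomial ℚ) (RatFunc ℚ)) (Polynomial.X ^ n) =
      algebraMap (Polynomial ℚ) (RatFunc ℚ) 1 := by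
    rw [map_pow, map_one, RatFunc.algebraMap_X]; exact h
  have h'' := congrArg Polynomial.natDegree (RatFunc.algebraMap_injective ℚ h')
  rw [Polynomial.natDegree_X_pow, Polynomial.natDegree_one] at h''
  exact hn h''

theorem tv_zpow_sub_ne_zero (m : ℕ) :
    tv ^ ((m : ℤ) + 1) - tv ^ (-((m : ℤ) + 1)) ≠ 0 := by
  intro h
  apply tv_pow_ne_one (n := 2 * (m + 1)) (by omega)
  have h₁ : tv ^ ((m : ℤ) + 1) = tv ^ (m + 1) := by exact_mod_cast zpow_natCast tv (m + 1)
  rw [zpow_neg, h₁, sub_eq_zero] at h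
  have h₂ := mul_inv_cancel₀ (pow_ne_zero (m + 1) tv_ne_zero)
  rwa [← h, ← pow_add, ← two_mul] at h₂

theorem qint_succ_ne_zero (m : ℕ) : qint ((m : ℤ) + 1) ≠ 0 := by
  refine div_ne_zero (tv_zpow_sub_ne_zero m) ?_
  simpa using tv_zpow_sub_ne_zero 0

theorem qint_two_mul (n : ℤ) : qint (2 * n) = qint n * (tv ^ n + tv ^ (-n)) := by
  have h : (2 * n : ℤ) = n + n := by ring
  rw [qint, qint, h, neg_add, zpow_add₀ tv_ne_zero, zpow_add₀ tv_ne_zero]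
  ring

theorem qnat_one : qnat 1 = tv + tv⁻¹ := by
  simp [qnat, Finset.sum_range_succ, add_comm]

theorem aGen_comm {I : Type} (G : SimpleGraph I) (i j : I) (m n : ℤ) (h : m + n ≠ 0) :
    aGen G i m * aGen G j n = aGen G j n * aGen G i m := by
  by_cases hm : m = 0
  · simp [aGen, hm]
  by_cases hn : n = 0
  · simp [aGen, hn]
  simp only [aGen, ne_eq, hm, hn, not_false_eq_true, dite_true, ← map_mul]
  exact RingQuot.mkAlgHom_rel K (HeisRel.comm i j ⟨m, hm⟩ ⟨n, hn⟩ h)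

theorem aGen_mul_aGen_neg {I : Type} (G : SimpleGraph I) (i j : I) (n : ℤ) (hn : 1 ≤ n) :
    aGen G j n * aGen G i (-n) =
      aGen G i (-n) * aGen G j n - algebraMap K (HeisAlg G) (kappa G i j n) := by
  have h := RingQuot.mkAlgHom_rel K (HeisRel.heis (G := G) i j n hn)
  rw [map_sub, map_mul, map_mul, AlgHom.commutes] at h
  have hn₀ : n ≠ 0 := by omega
  have hn₁ : -n ≠ 0 := by omega
  simp only [aGen, dif_pos hn₀, dif_pos hn₁]
  rw [← h]
  abel

/-- mixed commutation relation, Section 2 of the paper: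
`q_i^{(1^m)}·p_i^{(n)} = p_i^{(n)}·q_i^{(1^m)} + [2]·p_i^{(n-1)}·q_i^{(1^{m-1})}
 + p_i^{(n-2)}·q_i^{(1^{m-2})}` in `𝔥`, where `[2] = t + t⁻¹`. -/
theorem heisenberg_rel_qprime_p_same {I : Type} (G : SimpleGraph I) (i : I) (m n : ℕ) :
    qH' G i m * pH G i n =
      pH G i n * qH' G i m +
        qnat 1 • (pH G i ((n : ℤ) - 1) * qH' G i ((m : ℤ) - 1)) +
        pH G i ((n : ℤ) - 2) * qH' G i ((m : ℤ) - 2) := by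
  have htv := tv_ne_zero
  refine expSeq_mul_expSeq (F := K)
    (fun r => ((-1 : K) ^ r * ((r : K) + 1) / qint ((r : ℤ) + 1)) • aGen G i ((r : ℤ) + 1))
    (fun r => (((r : K) + 1) / qint ((r : ℤ) + 1)) • aGen G i (-((r : ℤ) + 1)))
    (pH G i) (qH' G i) (fun n hn => if_pos hn) (by simp [pH, pAux])
    (expSeq_rec_extend _ (pAux G i) _ (fun _ => rfl) fun n => ?_)
    (fun n hn => if_pos hn) (by simp [qH', qAux'])
    (expSeq_rec_extend _ (qAux' G i) _ (fun _ => rfl) fun n => ?_)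
    (fun k => -((-tv) ^ k + (-tv⁻¹) ^ k)) (qnat 1) (by norm_num) ?_ (fun k => ?_)
    (fun k r => ?_) m n
  · simp only [smul_mul_assoc]
    rw [pAux]
  · simp only [smul_mul_assoc]
    rw [qAux']
  · rw [qnat_one]; ring
  · rw [qnat_one]
    have h : tv * tv⁻¹ = 1 := mul_inv_cancel₀ htv
    linear_combination ((-tv) ^ k + (-tv⁻¹) ^ k) * h
  · simp only [smul_mul_smul_comm]
    split_ifs with hkr
    · subst hkr
      rw [aGen_mul_aGen_neg G i i _ (by omega), smul_sub, sub_eq_add_neg, mul_comm (_ / _)]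
      congr 1
      rw [Algebra.smul_def, ← map_mul, ← map_neg]
      congr 1
      have hr := qint_succ_ne_zero r
      have hr' : ((r : K) + 1) ≠ 0 := by exact_mod_cast Nat.succ_ne_zero r
      have h₁ : tv ^ ((r : ℤ) + 1) = tv ^ (r + 1) := by exact_mod_cast zpow_natCast tv (r + 1)
      rw [kappa, if_pos rfl, qint_two_mul, zpow_neg, h₁, neg_pow tv, neg_pow tv⁻¹, inv_pow]
      push_cast
      field_simp
      ring
    · rw [aGen_comm G i i _ _ (by omega), map_zero, add_zero, mul_comm (_ / _)]
end
end

section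
/- In the presented Heisenberg algebra 𝔥, for all adjacent vertices i ∼ j of the graph (i ≠ j, so ⟨i,j⟩ = −1) and all integers m, n ≥ 0 one has q_i^{(1^m)}·p_j^{(n)} = Σ_{k≥0} p_j^{(n−k)}·q_i^{(1^{m−k})}, where terms with negative superscripts vanish so the sum is finite. This is the mixed commutation relation between transposed and untransposed generators for adjacent vertices stated in Section 2 of the paper. -/
/-!
We formalize the quantum Heisenberg algebra `𝔥` associated to a simple graph with vertex
set `I` (in the paper, the affine Dynkin diagram of a nontrivial finite subgroup
`Γ ⊂ SL₂(ℂ)`, `Γ ≠ ℤ/2`), presented over `K = ℚ(t)` by generators `aᵢ(n)` (`i ∈ I`,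
`n ∈ ℤ ∖ {0}`) and the relations
`aᵢ(m)aⱼ(n) = aⱼ(n)aᵢ(m)` for `m + n ≠ 0` and
`aᵢ(-n)aⱼ(n) - aⱼ(n)aᵢ(-n) = κᵢⱼ(n)·1` for `n ≥ 1`, where `κᵢᵢ(n) = -[2n][n]/n`,
`κᵢⱼ(n) = (-1)ⁿ[n]²/n` if `i ∼ j` and `κᵢⱼ(n) = 0` otherwise.
-/

open scoped Classical

noncomputable section

namespace PowerSeries

variable {A : Type*} [Ring A]

/-- The Euler operator `f ↦ X · f'` on power series over a possibly noncommutative ring. -/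
def euler (f : A⟦X⟧) : A⟦X⟧ := mk fun n => n • coeff n f

@[simp]
theorem coeff_euler (f : A⟦X⟧) (n : ℕ) : coeff n (euler f) = n • coeff n f := coeff_mk _ _

theorem euler_sub (f g : A⟦X⟧) : euler (f - g) = euler f - euler g := by
  ext n
  simp [smul_sub]

theorem euler_mul (f g : A⟦X⟧) : euler (f * g) = euler f * g + f * euler g := by
  ext n
  simp only [coeff_euler, map_add, coeff_mul, Finset.smul_sum, ← Finset.sum_add_distrib]
  refine Finset.sum_congr rfl fun ij hij => ?_
  rw [← Finset.HasAntidiagonal.mem_antidiagonal.mp hij, add_smul, smul_mul_assoc, mul_smul_comm]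

@[simp]
theorem euler_C (a : A) : euler (C a) = 0 := by
  ext n
  rcases eq_or_ne n 0 with rfl | hn <;> simp [coeff_C, *]

theorem euler_X_pow (r : ℕ) : euler (X ^ r : A⟦X⟧) = r • X ^ r := by
  ext n
  rw [coeff_euler, map_nsmul, coeff_X_pow]
  split_ifs with h <;> simp [h]

/-- A solution of `X · f' = y · f` with `y` and `f` of zero constant term vanishes. -/
theorem eq_zero_of_euler_eq_mul [IsAddTorsionFree A] {y f : A⟦X⟧} (hy : coeff 0 y = 0)
    (hf : coeff 0 f = 0) (h : euler f = y * f) : f = 0 := by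
  ext n
  induction n using Nat.strong_induction_on with
  | _ n ih =>
    rcases eq_or_ne n 0 with rfl | hn
    · simpa using hf
    have hc := congrArg (coeff n) h
    rw [coeff_euler, coeff_mul, Finset.sum_eq_zero] at hc
    · rwa [nsmul_eq_zero_iff_right hn] at hc
    · rintro ⟨a, b⟩ hab
      rw [Finset.HasAntidiagonal.mem_antidiagonal] at hab
      rcases eq_or_ne a 0 with rfl | ha
      · simp only [hy, zero_mul]
      · simp only [ih b (by simp only at hab; omega), map_zero, mul_zero]

/-- Commutation of a Heisenberg generator with an exponential of dual generators. -/
theorem C_mul_eq_of_heisenberg [IsAddTorsionFree A] {a : A} {r : ℕ} (hr : r ≠ 0) {y p : A⟦X⟧}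
    (hy : coeff 0 y = 0) (hp : coeff 0 p = 1) (hyp : euler p = y * p)
    (hay : C a * y - y * C a = r • X ^ r) :
    C a * p = p * C a + X ^ r * p := by
  rw [← sub_eq_zero]
  refine eq_zero_of_euler_eq_mul hy ?_ ?_
  · rw [map_sub, map_add, coeff_C_mul, coeff_mul_C, coeff_X_pow_mul', hp]
    simp [hr]
  · have hXy : X ^ r * y = y * X ^ r := X_pow_mul
    rw [← sub_sub, euler_sub, euler_sub, euler_mul, euler_mul, euler_mul, euler_C, euler_X_pow, hyp,
      ← hay]
    have := congrArg (· * p) hXy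
    simp only [mul_assoc] at this
    simp only [mul_sub, sub_mul, mul_assoc, this]
    noncomm_ring

/-- The commutation relation `Q(z) P(w) = (1 - zw)⁻¹ P(w) Q(z)`, read off coefficientwise, for
exponentials `P` and `Q` with logarithmic derivatives `y` and `x` satisfying
`[x_r, y_s] = δ_{rs} r`. -/
theorem coeff_mul_coeff_of_heisenberg [IsAddTorsionFree A] {x y p q : A⟦X⟧}
    (hx : coeff 0 x = 0) (hy : coeff 0 y = 0) (hp : coeff 0 p = 1) (hq : coeff 0 q = 1)
    (hyp : euler p = y * p) (hxq : euler q = x * q)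
    (hxy : ∀ r s, coeff r x * coeff s y - coeff s y * coeff r x = if r = s then (r : A) else 0)
    (m n : ℕ) :
    coeff m q * coeff n p =
      ∑ k ∈ Finset.range (min m n + 1), coeff (n - k) p * coeff (m - k) q := by
  have hxp (r : ℕ) (hr : r ≠ 0) (k : ℕ) : coeff r x * coeff k p =
      coeff k p * coeff r x + if r ≤ k then coeff (k - r) p else 0 := by
    have h := C_mul_eq_of_heisenberg (a := coeff r x) hr hy hp hyp (by
      ext s
      rw [map_sub, coeff_C_mul, coeff_mul_C, hxy, map_nsmul, coeff_X_pow]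
      simp [eq_comm])
    have := congrArg (coeff k) h
    rwa [coeff_C_mul, map_add, coeff_mul_C, coeff_X_pow_mul'] at this
  set f : A⟦X⟧ := mk fun k => if k ≤ n then coeff (n - k) p else 0 with hf
  have hxf : x * f = f * x + euler f := by
    have hcomm (r k : ℕ) : coeff r x * coeff k f =
        coeff k f * coeff r x + if r = 0 then 0 else coeff (k + r) f := by
      rcases eq_or_ne r 0 with rfl | hr
      · simp only [hx, zero_mul, mul_zero, if_true, add_zero]
      simp only [hf, coeff_mk, if_neg hr]
      by_cases hk : k ≤ n
      · rw [if_pos hk, hxp r hr, Nat.sub_sub]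
        congr 1
        exact if_congr (by omega) rfl rfl
      · rw [if_neg hk, if_neg (by omega)]
        simp
    ext l
    rw [map_add, coeff_euler, coeff_mul, coeff_mul, ← Finset.Nat.sum_antidiagonal_swap]
    simp only [Prod.fst_swap, Prod.snd_swap, hcomm, Finset.sum_add_distrib]
    congr 1
    rw [← Finset.Nat.sum_antidiagonal_swap, Finset.Nat.sum_antidiagonal_eq_sum_range_succ_mk,
      Finset.sum_range_succ']
    simp only [Prod.fst_swap, Prod.snd_swap, if_true, add_zero, Nat.add_eq_zero_iff, one_ne_zero,
      and_false, if_false]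
    rw [Finset.sum_congr rfl (g := fun _ => coeff l f), Finset.sum_const, Finset.card_range]
    intro k hk
    rw [Nat.sub_add_cancel (Finset.mem_range.mp hk)]
  have hmain : q * C (coeff n p) = f * q := by
    rw [← sub_eq_zero]
    refine eq_zero_of_euler_eq_mul hx ?_ ?_
    · rw [map_sub, coeff_mul_C, coeff_mul, hq]
      simp [hf, hq]
    · rw [euler_sub, euler_mul, euler_mul, euler_C, hxq, mul_zero, add_zero, mul_sub,
        ← mul_assoc x f, hxf, add_mul, mul_assoc, mul_assoc]
      abel
  have := congrArg (coeff m) hmain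
  rw [coeff_mul_C, coeff_mul, Finset.Nat.sum_antidiagonal_eq_sum_range_succ_mk] at this
  rw [this]
  symm
  refine Finset.sum_subset_zero_on_sdiff (Finset.range_mono (by omega)) ?_ ?_
  · intro k hk
    simp only [Finset.mem_sdiff, Finset.mem_range] at hk
    simp only [hf, coeff_mk]
    rw [if_neg (by omega), zero_mul]
  · intro k hk
    rw [Finset.mem_range] at hk
    simp only [hf, coeff_mk]
    rw [if_pos (by omega)]

end PowerSeries

theorem qint_ne_zero {n : ℕ} (hn : n ≠ 0) : qint n ≠ 0 := by
  have htv : tv ≠ 0 := RatFunc.X_ne_zero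
  have key (k : ℕ) (hk : k ≠ 0) : tv ^ (k : ℤ) - tv ^ (-(k : ℤ)) ≠ 0 := by
    intro h
    have h1 : tv ^ (k + k) = 1 := by
      rw [zpow_neg, zpow_natCast, sub_eq_zero] at h
      rw [pow_add]
      nth_rewrite 1 [h]
      exact inv_mul_cancel₀ (pow_ne_zero _ htv)
    have h2 : (Polynomial.X : Polynomial ℚ) ^ (k + k) = 1 := by
      apply RatFunc.algebraMap_injective ℚ
      simpa [tv] using h1
    have h3 := congrArg Polynomial.natDegree h2
    simp at h3
    omega
  refine div_ne_zero (key n hn) ?_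
  simpa using key 1 one_ne_zero

section HeisenbergAlgebra

variable {I : Type} (G : SimpleGraph I)

theorem aGen_mul_comm (i j : I) {m n : ℤ} (h : m + n ≠ 0) :
    aGen G i m * aGen G j n = aGen G j n * aGen G i m := by
  unfold aGen
  split_ifs with hm hn
  · rw [← map_mul, ← map_mul]
    exact RingQuot.mkAlgHom_rel K (HeisRel.comm i j ⟨m, hm⟩ ⟨n, hn⟩ h)
  all_goals simp

theorem aGen_neg_mul_sub (i j : I) {n : ℤ} (hn : 1 ≤ n) :
    aGen G i (-n) * aGen G j n - aGen G j n * aGen G i (-n) =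
      algebraMap K (HeisAlg G) (kappa G i j n) := by
  have h := RingQuot.mkAlgHom_rel K (HeisRel.heis (G := G) i j n hn)
  rw [map_sub, map_mul, map_mul, AlgHom.commutes] at h
  unfold aGen
  rw [dif_pos (by omega), dif_pos (by omega)]
  exact h

instance : IsAddTorsionFree (HeisAlg G) where
  nsmul_right_injective n hn a b h := by
    simp only [← Nat.cast_smul_eq_nsmul K] at h
    exact smul_right_injective _ (Nat.cast_ne_zero.mpr hn) h

theorem smul_mul_smul_sub_of_mul_sub {F A : Type*} [Field F] [Ring A] [Algebra F A] {a b : A}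
    {κ : F} (h : b * a - a * b = algebraMap F A κ) (c d : F) :
    c • a * d • b - d • b * c • a = algebraMap F A (-(c * d * κ)) := by
  rw [smul_mul_smul_comm, smul_mul_smul_comm, mul_comm d c, ← smul_sub, ← neg_sub, h, map_neg,
    map_mul _ (c * d), ← Algebra.smul_def, smul_neg]

open PowerSeries in
/-- A sequence given by a recursion `(n + 1) u_{n+1} = Σ c_m b_m u_{n-m}` has generating series
solving the corresponding Euler equation. -/
theorem euler_mk_eq_mul {A : Type*} [Ring A] [Algebra K A] {u b : ℕ → A} {c : ℕ → K}
    (hu : ∀ n, u (n + 1) = ((n : K) + 1)⁻¹ • ∑ m ∈ Finset.range (n + 1),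
      c m • (b m * u (n - m))) :
    euler (mk u) = (X * mk fun m => c m • b m) * mk u := by
  ext n
  rcases n with _ | n
  · rw [mul_assoc, coeff_zero_X_mul, coeff_euler, zero_smul]
  rw [mul_assoc, coeff_succ_X_mul, coeff_euler, coeff_mk, hu, ← Nat.cast_smul_eq_nsmul K, smul_smul,
    Nat.cast_succ, mul_inv_cancel₀ (Nat.cast_add_one_ne_zero n), one_smul, coeff_mul,
    Finset.Nat.sum_antidiagonal_eq_sum_range_succ_mk]
  simp

open PowerSeries in
theorem qAux'_mul_pAux (i j : I) (hadj : G.Adj i j) (m n : ℕ) :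
    qAux' G i m * pAux G j n =
      ∑ k ∈ Finset.range (min m n + 1), pAux G j (n - k) * qAux' G i (m - k) := by
  have hp := euler_mk_eq_mul (u := pAux G j) (b := fun m => aGen G j (-((m : ℤ) + 1)))
    (c := fun m => ((m : K) + 1) / qint ((m : ℤ) + 1)) (fun n => by rw [pAux])
  have hq := euler_mk_eq_mul (u := qAux' G i) (b := fun m => aGen G i ((m : ℤ) + 1))
    (c := fun m => (-1 : K) ^ m * ((m : K) + 1) / qint ((m : ℤ) + 1)) (fun n => by rw [qAux'])
  have h := coeff_mul_coeff_of_heisenberg (coeff_zero_X_mul _) (coeff_zero_X_mul _)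
    (by rw [coeff_mk, pAux]) (by rw [coeff_mk, qAux']) hp hq ?_ m n
  · simpa only [coeff_mk] using h
  rintro (_ | r) (_ | s)
  · simp
  · simp
  · simp
  simp only [coeff_succ_X_mul, coeff_mk, add_left_inj]
  split_ifs with hrs
  · subst hrs
    have h0 : qint ((r : ℤ) + 1) ≠ 0 := by exact_mod_cast qint_ne_zero r.succ_ne_zero
    have h1 : ((r : K) + 1) ≠ 0 := Nat.cast_add_one_ne_zero r
    have hk : kappa G j i ((r : ℤ) + 1) =
        (-1 : K) ^ (r + 1) * qint ((r : ℤ) + 1) ^ 2 / ((r : K) + 1) := by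
      rw [kappa, if_neg hadj.ne', if_pos hadj.symm]
      norm_cast
    have h2 : (-1 : K) ^ r * (-1) ^ r = 1 := by rw [← mul_pow]; simp
    rw [smul_mul_smul_sub_of_mul_sub (aGen_neg_mul_sub G j i (by omega)), hk,
      ← map_natCast (algebraMap K (HeisAlg G))]
    congr 1
    push_cast
    field_simp
    linear_combination h2
  · rw [smul_mul_smul_comm, smul_mul_smul_comm, aGen_mul_comm G i j (by omega), mul_comm (_ / _),
      sub_self]

end HeisenbergAlgebra

/-- mixed commutation relation for adjacent vertices, Section 2 of the
paper: for `i ∼ j`, `q_i^{(1^m)}·p_j^{(n)} = Σ_{k≥0} p_j^{(n-k)}·q_i^{(1^{m-k})}`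
in `𝔥` (the terms with a negative superscript vanish, so the sum is finite). -/
theorem heisenberg_rel_qprime_p_adjacent {I : Type} (G : SimpleGraph I) (i j : I)
    (hadj : G.Adj i j) (m n : ℕ) :
    qH' G i m * pH G j n =
      ∑ k ∈ Finset.range (min m n + 1),
        pH G j ((n : ℤ) - (k : ℤ)) * qH' G i ((m : ℤ) - (k : ℤ)) := by
  have hp (k : ℕ) : pH G j k = pAux G j k := by simp [pH]
  have hq (k : ℕ) : qH' G i k = qAux' G i k := by simp [qH']
  rw [hp, hq, qAux'_mul_pAux G i j hadj]
  refine Finset.sum_congr rfl fun k hk => ?_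
  rw [Finset.mem_range] at hk
  rw [← Nat.cast_sub (by omega), ← Nat.cast_sub (by omega), hp, hq]
end
end

section
/- The bilinear form ⟨a, b⟩ := tr(a·b) on B^Γ = Λ*(V) ⋊ Γ is non-degenerate: if a ∈ B^Γ satisfies tr(a·b) = 0 for every b ∈ B^Γ, then a = 0 (equivalently, the pairing identifies B^Γ with its dual, so every basis of B^Γ admits a dual basis with respect to ⟨·,·⟩). -/
/-!
The algebra `B^Γ = Λ*(V) ⋊ Γ` for a finite subgroup `Γ ⊂ SL(V) ≅ SL₂(𝕜)`, where `V` is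
a two-dimensional `𝕜`-vector space with fixed basis `v₁, v₂` (modelled as `Fin 2 → 𝕜`
with its standard basis).  As a `𝕜`-vector space `B^Γ = Λ*(V) ⊗ 𝕜[Γ]`, modelled as
finitely supported functions `Γ →₀ Λ*(V)` (so `(x, γ)` is `single γ x`), with the smash
product multiplication `(x, γ)·(y, δ) = (x ∧ γ·y, γδ)`, and with the trace
`tr((ω, 1)) = 1` (`ω = v₁ ∧ v₂`), `tr = 0` on all other basis elements.
-/

noncomputable section

variable (𝕜 : Type) [Field 𝕜] [IsAlgClosed 𝕜] [CharZero 𝕜]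

/-- The two-dimensional vector space `V`. -/
abbrev V (𝕜 : Type) [Field 𝕜] : Type := Fin 2 → 𝕜

/-- The exterior algebra `Λ*(V)`. -/
abbrev ExtV (𝕜 : Type) [Field 𝕜] : Type := ExteriorAlgebra 𝕜 (V 𝕜)

/-- The algebra endomorphism of `Λ*(V)` induced functorially by a linear map `V → V`. -/
def actE (f : V 𝕜 →ₗ[𝕜] V 𝕜) : ExtV 𝕜 →ₐ[𝕜] ExtV 𝕜 :=
  ExteriorAlgebra.lift 𝕜
    ⟨(ExteriorAlgebra.ι 𝕜).comp f, fun m => ExteriorAlgebra.ι_sq_zero (f m)⟩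

variable (Γ : Subgroup (Matrix.SpecialLinearGroup (Fin 2) 𝕜)) [Finite Γ]

/-- The underlying `𝕜`-vector space of `B^Γ = Λ*(V) ⋊ Γ`: finitely supported functions
`Γ →₀ Λ*(V)`; the element `(x, γ)` is `Finsupp.single γ x`. -/
abbrev BG : Type := Γ →₀ ExtV 𝕜

/-- The smash product multiplication on `B^Γ`:
`(x, γ)·(y, δ) = (x ∧ (γ·y), γδ)`, extended bilinearly.  Here `γ ∈ Γ ⊂ SL₂(𝕜)` acts on
`Λ*(V)` through its (matrix) action on `V`. -/
def mulB (f g : BG 𝕜 Γ) : BG 𝕜 Γ :=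
  f.sum fun α x => g.sum fun β y =>
    Finsupp.single (α * β)
      (x * actE 𝕜 (Matrix.toLin' ((α : Matrix.SpecialLinearGroup (Fin 2) 𝕜) :
        Matrix (Fin 2) (Fin 2) 𝕜)) y)

/-- The family of alternating maps defining the `ω`-coefficient functional on `Λ*(V)`:
the determinant in degree `2` and zero in all other degrees. -/
def altFam : ∀ i : ℕ, (V 𝕜) [⋀^Fin i]→ₗ[𝕜] 𝕜
  | 2 => Matrix.detRowAlternating
  | _ => 0

/-- The `ω`-coefficient functional `Λ*(V) → 𝕜`: the unique linear map vanishing in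
degrees `≠ 2` and sending `ι v * ι w` to `det(v, w)`; in particular it sends
`ω = v₁ ∧ v₂` to `1` and kills `1, v₁, v₂`. -/
def omegaCoeff : ExtV 𝕜 →ₗ[𝕜] 𝕜 :=
  ExteriorAlgebra.liftAlternating (altFam 𝕜)

/-- The trace `tr : B^Γ → 𝕜`, with `tr((ω, 1)) = 1` and `tr = 0` on `(x, γ)` for
`γ ≠ 1` or `x` of exterior degree `≤ 1`. -/
def trB (b : BG 𝕜 Γ) : 𝕜 := omegaCoeff 𝕜 (b 1)

/-- `b ∈ B^Γ` is homogeneous of degree `d` if every `Λ*(V)`-component of `b` lies in the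
`d`-th graded piece `Λᵈ(V)` (the `d`-th power of the image of `V` in `Λ*(V)`). -/
def IsHomog (d : ℕ) (b : BG 𝕜 Γ) : Prop :=
  ∀ γ : Γ, b γ ∈ (LinearMap.range (ExteriorAlgebra.ι 𝕜 : V 𝕜 →ₗ[𝕜] ExtV 𝕜)) ^ d

section ExteriorAlgebraOfPlane

open ExteriorAlgebra

variable {K : Type} [Field K]

theorem omegaCoeff_one : omegaCoeff K 1 = 0 := by
  simp [omegaCoeff, altFam]

theorem omegaCoeff_ι (v : V K) : omegaCoeff K (ι K v) = 0 := by
  simp [omegaCoeff, altFam]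

theorem omegaCoeff_ι_mul_ι (v w : V K) :
    omegaCoeff K (ι K v * ι K w) = v 0 * w 1 - v 1 * w 0 := by
  have hι : ι K v * ι K w = ιMulti K 2 ![v, w] := by simp [ιMulti_apply]
  rw [hι, omegaCoeff, liftAlternating_apply_ιMulti]
  change Matrix.det (Matrix.of ![v, w]) = _
  rw [Matrix.det_fin_two]
  simp

theorem ι_eq_smul_add_smul (v : V K) :
    ι K v = v 0 • ι K (Pi.single 0 1 : V K) + v 1 • ι K (Pi.single 1 1 : V K) := by
  rw [← map_smul, ← map_smul, ← map_add]
  congr 1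
  ext i
  fin_cases i <;> simp

/-- The exterior algebra of the plane is spanned by `1, v₁, v₂, v₁ ∧ v₂`. -/
theorem exists_eq_extV_basis (x : ExtV K) :
    ∃ c : Fin 4 → K, x = c 0 • 1 + c 1 • ι K (Pi.single 0 1 : V K) +
      c 2 • ι K (Pi.single 1 1 : V K) +
      c 3 • (ι K (Pi.single 0 1 : V K) * ι K (Pi.single 1 1 : V K)) := by
  induction x using CliffordAlgebra.left_induction with
  | algebraMap r => exact ⟨![r, 0, 0, 0], by simp [Algebra.algebraMap_eq_smul_one]⟩
  | add x y hx hy =>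
    obtain ⟨c, rfl⟩ := hx
    obtain ⟨d, rfl⟩ := hy
    refine ⟨c + d, ?_⟩
    simp only [Pi.add_apply, add_smul]
    abel
  | ι_mul x m hx =>
    obtain ⟨c, rfl⟩ := hx
    refine ⟨![0, c 0 * m 0, c 0 * m 1, c 2 * m 0 - c 1 * m 1], ?_⟩
    change ι K m * _ = _
    rw [ι_eq_smul_add_smul m]
    have h₀ := ι_sq_zero (R := K) (Pi.single 0 1 : V K)
    have h₁ := ι_sq_zero (R := K) (Pi.single 1 1 : V K)
    have h₁₀ := eq_neg_of_add_eq_zero_right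
      (ι_add_mul_swap (R := K) (Pi.single 0 1 : V K) (Pi.single 1 1 : V K))
    generalize ι K (Pi.single 0 1 : V K) = p at *
    generalize ι K (Pi.single 1 1 : V K) = q at *
    have h₀₁ : p * (p * q) = 0 := by rw [← mul_assoc, h₀, zero_mul]
    have h₁₀₁ : q * (p * q) = 0 := by
      rw [← mul_assoc, h₁₀, neg_mul, mul_assoc, h₁, mul_zero, neg_zero]
    simp only [mul_add, add_mul, smul_mul_assoc, mul_smul_comm, mul_one, h₀, h₁, h₁₀, h₀₁, h₁₀₁,
      smul_zero, Matrix.cons_val]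
    module

/-- The pairing `(x, y) ↦ omegaCoeff (x ∧ y)` on the exterior algebra is non-degenerate. -/
theorem eq_zero_of_omegaCoeff_mul_eq_zero (x : ExtV K)
    (h : ∀ y : ExtV K, omegaCoeff K (x * y) = 0) : x = 0 := by
  obtain ⟨c, rfl⟩ := exists_eq_extV_basis x
  have hω := omegaCoeff_ι_mul_ι (Pi.single 0 1 : V K) (Pi.single 1 1)
  have hω' := omegaCoeff_ι_mul_ι (Pi.single 1 1 : V K) (Pi.single 0 1)
  have ho₀ := omegaCoeff_ι (Pi.single 0 1 : V K)
  have ho₁ := omegaCoeff_ι (Pi.single 1 1 : V K)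
  have h₀ := ι_sq_zero (R := K) (Pi.single 0 1 : V K)
  have h₁ := ι_sq_zero (R := K) (Pi.single 1 1 : V K)
  have h₁₀ := eq_neg_of_add_eq_zero_right
    (ι_add_mul_swap (R := K) (Pi.single 0 1 : V K) (Pi.single 1 1 : V K))
  generalize ι K (Pi.single 0 1 : V K) = p at *
  generalize ι K (Pi.single 1 1 : V K) = q at *
  have c₃ : c 3 = 0 := by simpa [omegaCoeff_one, ho₀, ho₁, hω] using h 1
  have c₂ : c 2 = 0 := by
    simpa [c₃, add_mul, ho₀, h₀, hω'] using h p
  have c₁ : c 1 = 0 := by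
    simpa [c₃, add_mul, ho₁, h₁, hω] using h q
  have c₀ : c 0 = 0 := by simpa [c₁, c₂, c₃, hω] using h (p * q)
  simp [c₀, c₁, c₂, c₃]

theorem actE_actE_of_comp_eq_id {f g : V K →ₗ[K] V K} (hfg : f ∘ₗ g = LinearMap.id)
    (x : ExtV K) : actE K f (actE K g x) = x := by
  suffices (actE K f).comp (actE K g) = AlgHom.id K (ExtV K) from DFunLike.congr_fun this x
  refine ExteriorAlgebra.hom_ext (LinearMap.ext fun v => ?_)
  simpa [actE] using congrArg (ι K) (LinearMap.congr_fun hfg v)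

theorem trB_mulB_single_inv (G : Subgroup (Matrix.SpecialLinearGroup (Fin 2) K)) (a : BG K G)
    (γ : G) (y : ExtV K) :
    trB K G (mulB K G a (Finsupp.single γ⁻¹ y)) = omegaCoeff K (a γ *
      actE K (Matrix.toLin' ((γ : Matrix.SpecialLinearGroup (Fin 2) K) :
        Matrix (Fin 2) (Fin 2) K)) y) := by
  classical
  rw [trB, mulB, Finsupp.sum_apply, Finsupp.sum, map_sum, Finset.sum_eq_single γ]
  · simp
  · intro β _ hβ
    rw [Finsupp.sum_single_index (by simp), Finsupp.single_eq_of_ne, map_zero]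
    simpa [eq_comm, mul_inv_eq_one] using hβ
  · intro hγ
    simp [Finsupp.notMem_support_iff.mp hγ]

end ExteriorAlgebraOfPlane

/-- the bilinear form `⟨a, b⟩ = tr(a·b)` on `B^Γ = Λ*(V) ⋊ Γ` is
non-degenerate: if `tr(a·b) = 0` for every `b ∈ B^Γ`, then `a = 0`. -/
theorem trB_nondegenerate (a : BG 𝕜 Γ)
    (h : ∀ b : BG 𝕜 Γ, trB 𝕜 Γ (mulB 𝕜 Γ a b) = 0) : a = 0 := by
  ext γ : 1
  refine eq_zero_of_omegaCoeff_mul_eq_zero (a γ) fun y => ?_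
  have hγ := h (Finsupp.single γ⁻¹ (actE 𝕜 (Matrix.toLin'
    ((γ⁻¹ : Matrix.SpecialLinearGroup (Fin 2) 𝕜) : Matrix (Fin 2) (Fin 2) 𝕜)) y))
  rwa [trB_mulB_single_inv, actE_actE_of_comp_eq_id] at hγ
  rw [← Matrix.toLin'_mul, ← Matrix.SpecialLinearGroup.coe_mul, mul_inv_cancel,
    Matrix.SpecialLinearGroup.coe_one, Matrix.toLin'_one]
end
end
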